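/- arXiv:1808.05714 — 4 statements merged into one kernel-verified Lean document; each statement's English description precedes it below -/
import Mathlib

section
/- Let λ ∈ ℂ and let v₁, v₂ : ℤ → ℂ² satisfy v_j(x+1) = T_λ(x)·v_j(x) for all x ∈ ℤ, with W_λ := det(v₁(x)|v₂(x)) ≠ 0 (this determinant is independent of x). Define the 2×2-matrix-valued kernel K_λ(x,y) := e^{−iλ}·W_λ⁻¹·( v₂(x)·v₁(y)ᵀ·[[0, 1_{x<y}],[1_{x≤y}, 0]] + v₁(x)·v₂(y)ᵀ·[[0, 1_{x≥y}],[1_{x>y}, 0]] ), where 1_P is 1 if P holds and 0 otherwise and v·wᵀ denotes the outer product of column vectors. Then, applying 𝒞 − e^{iλ} columnwise in the variable x, ((𝒞 − e^{iλ})K_λ(·,y))(x) equals the 2×2 identity matrix when x = y and the zero matrix when x ≠ y. -/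
open Complex Matrix

noncomputable section

/-- The coin matrix `C_{α,β,θ} = e^{iθ}[[β, conj α],[−α, conj β]]`. -/
def coinMat (a b : ℂ) (t : ℝ) : Matrix (Fin 2) (Fin 2) ℂ :=
  Complex.exp ((t : ℂ) * Complex.I) • !![b, (starRingEnd ℂ) a; -a, (starRingEnd ℂ) b]

/-- The quantum walk evolution operator `U = SĈ`, acting on arbitrary `u : ℤ → ℂ²`:
`(Uu)↑(x) = (C(x−1)u(x−1))↑`, `(Uu)↓(x) = (C(x+1)u(x+1))↓`. -/
def qw (C : ℤ → Matrix (Fin 2) (Fin 2) ℂ) (u : ℤ → Fin 2 → ℂ) : ℤ → Fin 2 → ℂ :=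
  fun x => ![(C (x - 1)).mulVec (u (x - 1)) 0, (C (x + 1)).mulVec (u (x + 1)) 1]

/-- `ρ = √(1−|a|²)`. -/
def rho (a : ℂ) : ℝ := Real.sqrt (1 - ‖a‖ ^ 2)

/-- The coin map `x ↦ C_{α(x), ρ(x), θ(x)}`. -/
def coinOf (α : ℤ → ℂ) (θ : ℤ → ℝ) : ℤ → Matrix (Fin 2) (Fin 2) ℂ :=
  fun x => coinMat (α x) ((rho (α x) : ℝ) : ℂ) (θ x)

/-- The transfer matrix `T_λ(x)`. -/
def Tmat (α : ℤ → ℂ) (θ : ℤ → ℝ) (lam : ℂ) (x : ℤ) : Matrix (Fin 2) (Fin 2) ℂ :=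
  (((rho (α x) : ℝ) : ℂ))⁻¹ •
    !![Complex.exp (Complex.I * (lam - (θ x : ℂ))), α x;
       (starRingEnd ℂ) (α x), Complex.exp (-(Complex.I * (lam - (θ x : ℂ))))]

/-- `(J_VE u)(x) = (u↓(x−1), u↑(x))`. -/
def Jve (u : ℤ → Fin 2 → ℂ) : ℤ → Fin 2 → ℂ := fun x => ![u (x - 1) 1, u x 0]

/-- `(J_EV v)(x) = (v↓(x), v↑(x+1))`, the inverse of `J_VE`. -/
def Jev (v : ℤ → Fin 2 → ℂ) : ℤ → Fin 2 → ℂ := fun x => ![v x 1, v (x + 1) 0]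

/-- Determinant of the 2×2 matrix with columns `v, w`. -/
def det2 (v w : Fin 2 → ℂ) : ℂ := v 0 * w 1 - v 1 * w 0

/-- The Euclidean norm on ℂ². -/
def nrm2 (v : Fin 2 → ℂ) : ℝ := Real.sqrt (‖v 0‖ ^ 2 + ‖v 1‖ ^ 2)

/-- Membership in `l²(ℤ, ℂ²)`. -/
def MemL2 (u : ℤ → Fin 2 → ℂ) : Prop := Summable fun x : ℤ => ‖u x 0‖ ^ 2 + ‖u x 1‖ ^ 2

/-- The Japanese bracket `⟨x⟩ = √(1+x²)`. -/
def jp (x : ℤ) : ℝ := Real.sqrt (1 + (x : ℝ) ^ 2)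

/-- Complex indicator of a decidable proposition. -/
def indC (P : Prop) [Decidable P] : ℂ := if P then 1 else 0

/-- The kernel `K_λ(x,y)` built from two solutions `v₁, v₂` with Wronskian `W`. -/
def Kker (v₁ v₂ : ℤ → Fin 2 → ℂ) (lam W : ℂ) (x y : ℤ) : Matrix (Fin 2) (Fin 2) ℂ :=
  Complex.exp (-(Complex.I * lam)) • W⁻¹ •
    (Matrix.vecMulVec (v₂ x) (v₁ y) * !![0, indC (x < y); indC (x ≤ y), 0]
      + Matrix.vecMulVec (v₁ x) (v₂ y) * !![0, indC (y ≤ x); indC (y < x), 0])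

theorem ofReal_rho_sq {a : ℂ} (ha : ‖a‖ < 1) :
    ((rho a : ℝ) : ℂ) ^ 2 = 1 - a * (starRingEnd ℂ) a := by
  have h : (rho a) ^ 2 = 1 - ‖a‖ ^ 2 := Real.sq_sqrt (by nlinarith [norm_nonneg a])
  rw [Complex.mul_conj, Complex.normSq_eq_norm_sq]
  exact_mod_cast h

theorem ofReal_rho_ne_zero {a : ℂ} (ha : ‖a‖ < 1) : ((rho a : ℝ) : ℂ) ≠ 0 := by
  have h : 0 < rho a := Real.sqrt_pos.mpr (by nlinarith [norm_nonneg a])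
  exact_mod_cast h.ne'

theorem exp_mul_exp_sub (t : ℝ) (lam : ℂ) :
    Complex.exp (t * Complex.I) * Complex.exp (Complex.I * (lam - t))
      = Complex.exp (Complex.I * lam) := by
  rw [← Complex.exp_add]; ring_nf

theorem exp_mul_exp_neg_sub (t : ℝ) (lam : ℂ) :
    Complex.exp (Complex.I * lam) * Complex.exp (-(Complex.I * (lam - t)))
      = Complex.exp (t * Complex.I) := by
  rw [← Complex.exp_add]; ring_nf

section TransferSolution

variable {α : ℤ → ℂ} {θ : ℤ → ℝ} {lam : ℂ} {x : ℤ} {v w : Fin 2 → ℂ}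

/-- The upper component of the eigenvalue equation `𝒞 v = e^{iλ} v` for a solution of the
transfer equation. -/
theorem coin_down_of_transfer (hα : ‖α x‖ < 1) (h : w = (Tmat α θ lam x).mulVec v) :
    Complex.exp (θ x * Complex.I) * (-α x * v 1 + (rho (α x) : ℂ) * w 0)
      = Complex.exp (Complex.I * lam) * v 0 := by
  have hρ := ofReal_rho_ne_zero hα
  have h0 : (rho (α x) : ℂ) * w 0
      = Complex.exp (Complex.I * (lam - θ x)) * v 0 + α x * v 1 := by
    subst h
    simp [Tmat, Matrix.mulVec, dotProduct, Fin.sum_univ_two]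
    field_simp
  linear_combination Complex.exp (θ x * Complex.I) * h0 + v 0 * exp_mul_exp_sub (θ x) lam

/-- The lower component of the eigenvalue equation `𝒞 v = e^{iλ} v` for a solution of the
transfer equation. -/
theorem coin_up_of_transfer (hα : ‖α x‖ < 1) (h : w = (Tmat α θ lam x).mulVec v) :
    Complex.exp (θ x * Complex.I) * ((rho (α x) : ℂ) * v 1 + (starRingEnd ℂ) (α x) * w 0)
      = Complex.exp (Complex.I * lam) * w 1 := by
  have hρ := ofReal_rho_ne_zero hα
  have h0 := coin_down_of_transfer hα h
  have h1 : (rho (α x) : ℂ) * w 1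
      = (starRingEnd ℂ) (α x) * v 0 + Complex.exp (-(Complex.I * (lam - θ x))) * v 1 := by
    subst h
    simp [Tmat, Matrix.mulVec, dotProduct, Fin.sum_univ_two]
    field_simp
  apply mul_left_cancel₀ hρ
  linear_combination (starRingEnd ℂ) (α x) * h0 - Complex.exp (Complex.I * lam) * h1
    + Complex.exp (θ x * Complex.I) * v 1 * ofReal_rho_sq hα
    - v 1 * exp_mul_exp_neg_sub (θ x) lam

end TransferSolution

theorem Jve_qw_Jev_zero (α : ℤ → ℂ) (θ : ℤ → ℝ) (u : ℤ → Fin 2 → ℂ) (x : ℤ) :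
    Jve (qw (coinOf α θ) (Jev u)) x 0
      = Complex.exp (θ x * Complex.I) * (-α x * u x 1 + (rho (α x) : ℂ) * u (x + 1) 0) := by
  simp [Jve, qw, Jev, coinOf, coinMat, Matrix.mulVec, dotProduct, Fin.sum_univ_two]
  ring

theorem Jve_qw_Jev_one (α : ℤ → ℂ) (θ : ℤ → ℝ) (u : ℤ → Fin 2 → ℂ) (x : ℤ) :
    Jve (qw (coinOf α θ) (Jev u)) (x + 1) 1
      = Complex.exp (θ x * Complex.I)
        * ((rho (α x) : ℂ) * u x 1 + (starRingEnd ℂ) (α x) * u (x + 1) 0) := by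
  simp [Jve, qw, Jev, coinOf, coinMat, Matrix.mulVec, dotProduct, Fin.sum_univ_two]
  ring

theorem Kker_apply_zero (v₁ v₂ : ℤ → Fin 2 → ℂ) (lam W : ℂ) (x y : ℤ) (i : Fin 2) :
    Kker v₁ v₂ lam W x y i 0 = Complex.exp (-(Complex.I * lam)) * W⁻¹
      * if x ≤ y then v₂ x i * v₁ y 1 else v₁ x i * v₂ y 1 := by
  rcases le_or_gt x y with h | h
  · simp [Kker, indC, Matrix.mul_apply, Matrix.vecMulVec_apply, Fin.sum_univ_two, h, h.not_gt,
      mul_assoc]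
  · simp [Kker, indC, Matrix.mul_apply, Matrix.vecMulVec_apply, Fin.sum_univ_two, h, h.not_ge,
      mul_assoc]

theorem Kker_apply_one (v₁ v₂ : ℤ → Fin 2 → ℂ) (lam W : ℂ) (x y : ℤ) (i : Fin 2) :
    Kker v₁ v₂ lam W x y i 1 = Complex.exp (-(Complex.I * lam)) * W⁻¹
      * if x < y then v₂ x i * v₁ y 0 else v₁ x i * v₂ y 0 := by
  rcases lt_or_ge x y with h | h
  · simp [Kker, indC, Matrix.mul_apply, Matrix.vecMulVec_apply, Fin.sum_univ_two, h, h.not_ge,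
      mul_assoc]
  · simp [Kker, indC, Matrix.mul_apply, Matrix.vecMulVec_apply, Fin.sum_univ_two, h, h.not_gt,
      mul_assoc]

/-- `(𝒞 − e^{iλ})K_λ(·,y)` is the identity matrix at `x = y` and zero
otherwise, where `𝒞 = J_VE ∘ U ∘ J_EV` is applied columnwise in `x`. -/
theorem stmt5 (α : ℤ → ℂ) (θ : ℤ → ℝ) (hα : ∀ x : ℤ, ‖α x‖ < 1) (lam : ℂ)
    (v₁ v₂ : ℤ → Fin 2 → ℂ)
    (h₁ : ∀ x : ℤ, v₁ (x + 1) = (Tmat α θ lam x).mulVec (v₁ x))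
    (h₂ : ∀ x : ℤ, v₂ (x + 1) = (Tmat α θ lam x).mulVec (v₂ x))
    (W : ℂ) (hW : ∀ x : ℤ, det2 (v₁ x) (v₂ x) = W) (hW0 : W ≠ 0) :
    ∀ y x : ℤ, ∀ i j : Fin 2,
      Jve (qw (coinOf α θ) (Jev (fun x' => fun i' => Kker v₁ v₂ lam W x' y i' j))) x i
          - Complex.exp (Complex.I * lam) * Kker v₁ v₂ lam W x y i j
        = if x = y then (1 : Matrix (Fin 2) (Fin 2) ℂ) i j else 0 := by
  intro y x i j
  have hE : Complex.exp (-(Complex.I * lam)) * Complex.exp (Complex.I * lam) = 1 := by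
    rw [← Complex.exp_add]; simp
  have hWi : W⁻¹ * W = 1 := inv_mul_cancel₀ hW0
  have hWx := hW x
  unfold det2 at hWx
  set E := Complex.exp (Complex.I * lam)
  set F := Complex.exp (-(Complex.I * lam)) with hF
  match i with
  | 0 =>
    rw [Jve_qw_Jev_zero]
    have d₁ := coin_down_of_transfer (hα x) (h₁ x)
    have d₂ := coin_down_of_transfer (hα x) (h₂ x)
    match j with
    | 0 =>
      simp only [Kker_apply_zero, ← hF]
      rcases lt_trichotomy x y with h | rfl | h
      · simp only [h.le, h.ne, Int.add_one_le_iff.mpr h, if_true, if_false]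
        linear_combination F * W⁻¹ * v₁ y 1 * d₂
      · simp only [le_refl, (lt_add_one x).not_ge, if_true, if_false, Matrix.one_apply_eq]
        linear_combination F * W⁻¹ * v₂ x 1 * d₁ + F * W⁻¹ * E * hWx + F * E * hWi + hE
      · simp only [h.not_ge, h.ne', (h.trans (lt_add_one x)).not_ge, if_false]
        linear_combination F * W⁻¹ * v₂ y 1 * d₁
    | 1 =>
      simp only [Kker_apply_one, ← hF]
      have hoff : (if x = y then (1 : Matrix (Fin 2) (Fin 2) ℂ) 0 1 else 0) = 0 := by simp
      rw [hoff]
      rcases lt_or_ge x y with h | h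
      · rcases (Int.add_one_le_iff.mpr h).lt_or_eq with h' | rfl
        · simp only [h, h', if_true]
          linear_combination F * W⁻¹ * v₁ y 0 * d₂
        · simp only [h, lt_irrefl, if_true, if_false]
          linear_combination F * W⁻¹ * v₁ (x + 1) 0 * d₂
      · simp only [h.not_gt, (h.trans (lt_add_one x).le).not_gt, if_false]
        linear_combination F * W⁻¹ * v₂ y 0 * d₁
  | 1 =>
    obtain ⟨z, rfl⟩ : ∃ z, x = z + 1 := ⟨x - 1, by ring⟩
    rw [Jve_qw_Jev_one]
    have d₁ := coin_up_of_transfer (hα z) (h₁ z)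
    have d₂ := coin_up_of_transfer (hα z) (h₂ z)
    match j with
    | 0 =>
      simp only [Kker_apply_zero, ← hF]
      have hoff : (if z + 1 = y then (1 : Matrix (Fin 2) (Fin 2) ℂ) 1 0 else 0) = 0 := by simp
      rw [hoff]
      rcases lt_trichotomy z y with h | rfl | h
      · simp only [h.le, Int.add_one_le_iff.mpr h, if_true]
        linear_combination F * W⁻¹ * v₁ y 1 * d₂
      · simp only [le_refl, (lt_add_one z).not_ge, if_true, if_false]
        linear_combination F * W⁻¹ * v₂ z 1 * d₁
      · simp only [h.not_ge, (h.trans (lt_add_one z)).not_ge, if_false]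
        linear_combination F * W⁻¹ * v₂ y 1 * d₁
    | 1 =>
      simp only [Kker_apply_one, ← hF]
      rcases lt_trichotomy (z + 1) y with h | rfl | h
      · simp only [h, h.ne, (lt_add_one z).trans h, if_true, if_false]
        linear_combination F * W⁻¹ * v₁ y 0 * d₂
      · simp only [lt_add_one, lt_irrefl, if_true, if_false, Matrix.one_apply_eq]
        linear_combination F * W⁻¹ * v₁ (z + 1) 0 * d₂ + F * W⁻¹ * E * hWx + F * E * hWi + hE
      · simp only [h.not_gt, h.ne', (Int.lt_add_one_iff.mp h).not_gt, if_false]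
        linear_combination F * W⁻¹ * v₂ y 0 * d₁
end
end

section
/- Assume Σ_{x∈ℤ}(|α(x)−α₀| + |θ(x)|) < ∞. Then every eigenvalue of U is simple: for every w ∈ ℂ, the subspace {u ∈ l²(ℤ,ℂ²) : Uu = wu} has dimension at most 1. -/
open Complex Matrix

noncomputable section

theorem rho_ne_zero {a : ℂ} (ha : ‖a‖ < 1) : (rho a : ℂ) ≠ 0 := by
  have : 0 < rho a := Real.sqrt_pos.2 (by nlinarith [norm_nonneg a])
  exact_mod_cast this.ne'

theorem rho_sq_add {a : ℂ} (ha : ‖a‖ < 1) :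
    (rho a : ℂ) ^ 2 + a * (starRingEnd ℂ) a = 1 := by
  have h : rho a ^ 2 = 1 - ‖a‖ ^ 2 := Real.sq_sqrt (by nlinarith [norm_nonneg a])
  rw [Complex.mul_conj, Complex.normSq_eq_norm_sq]
  exact_mod_cast (by linarith : rho a ^ 2 + ‖a‖ ^ 2 = 1)

theorem qw_eigen_up {α : ℤ → ℂ} {θ : ℤ → ℝ} {w : ℂ} {u : ℤ → Fin 2 → ℂ}
    (h : ∀ x, qw (coinOf α θ) u x = w • u x) (x : ℤ) :
    w * u (x + 1) 0 =
      Complex.exp (θ x * Complex.I) * (rho (α x) * u x 0 + (starRingEnd ℂ) (α x) * u x 1) := by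
  have := congrFun (h (x + 1)) 0
  simp [qw, coinOf, coinMat, Matrix.mulVec, dotProduct, Fin.sum_univ_two] at this
  rw [← this]; ring

theorem qw_eigen_down {α : ℤ → ℂ} {θ : ℤ → ℝ} {w : ℂ} {u : ℤ → Fin 2 → ℂ}
    (h : ∀ x, qw (coinOf α θ) u x = w • u x) (x : ℤ) :
    w * u (x - 1) 1 =
      Complex.exp (θ x * Complex.I) * (-α x * u x 0 + rho (α x) * u x 1) := by
  have := congrFun (h (x - 1)) 1
  simp [qw, coinOf, coinMat, Matrix.mulVec, dotProduct, Fin.sum_univ_two] at this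
  rw [← this]; ring

theorem qw_kernel_trivial {α : ℤ → ℂ} {θ : ℤ → ℝ} {u : ℤ → Fin 2 → ℂ} (hα : ∀ x, ‖α x‖ < 1)
    (h : ∀ x, qw (coinOf α θ) u x = (0 : ℂ) • u x) (x : ℤ) : u x = 0 := by
  have hup := qw_eigen_up h x
  have hdown := qw_eigen_down h x
  simp only [zero_mul, zero_eq_mul, Complex.exp_ne_zero, false_or] at hup hdown
  have hR := rho_sq_add (hα x)
  ext i
  fin_cases i
  · simp only [Fin.zero_eta, Pi.zero_apply]
    linear_combination rho (α x) * hup - (starRingEnd ℂ) (α x) * hdown - u x 0 * hR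
  · simp only [Fin.mk_one, Pi.zero_apply]
    linear_combination α x * hup + rho (α x) * hdown - u x 1 * hR

/-- The Wronskian of two generalized eigenfunctions is independent of the position. -/
theorem det2_Jve_eq {α : ℤ → ℂ} {θ : ℤ → ℝ} {w : ℂ} (hw : w ≠ 0) {u v : ℤ → Fin 2 → ℂ}
    (hu : ∀ x, qw (coinOf α θ) u x = w • u x) (hv : ∀ x, qw (coinOf α θ) v x = w • v x)
    (x : ℤ) : det2 (Jve u x) (Jve v x) = det2 (Jve u 0) (Jve v 0) := by
  have step : ∀ x, det2 (Jve u (x + 1)) (Jve v (x + 1)) = det2 (Jve u x) (Jve v x) := by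
    intro x
    apply mul_left_cancel₀ hw
    simp only [det2, Jve, add_sub_cancel_right, Matrix.cons_val_zero, Matrix.cons_val_one]
    linear_combination u x 1 * qw_eigen_up hv x - v x 1 * qw_eigen_up hu x
      - v x 0 * qw_eigen_down hu x + u x 0 * qw_eigen_down hv x
  induction x with
  | zero => rfl
  | succ n ih => rw [step, ih]
  | pred n ih => rw [← ih, ← step, sub_add_cancel]

theorem MemL2.tendsto_Jve {u : ℤ → Fin 2 → ℂ} (hu : MemL2 u) (i : Fin 2) :
    Filter.Tendsto (fun x => Jve u x i) Filter.cofinite (nhds 0) := by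
  have key : ∀ j, Filter.Tendsto (fun x => u x j) Filter.cofinite (nhds 0) := by
    intro j
    have hj : Filter.Tendsto (fun x => ‖u x j‖ ^ 2) Filter.cofinite (nhds 0) := by
      refine squeeze_zero (fun x => by positivity) (fun x => ?_) hu.tendsto_cofinite_zero
      fin_cases j <;> simp
    rw [tendsto_zero_iff_norm_tendsto_zero]
    simpa using hj.sqrt
  fin_cases i
  · exact (key 1).comp (sub_left_injective (b := (1 : ℤ))).tendsto_cofinite
  · exact key 0

theorem eq_zero_of_Jve_zero {α : ℤ → ℂ} {θ : ℤ → ℝ} {w : ℂ} (hw : w ≠ 0)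
    (hα : ∀ x, ‖α x‖ < 1) {u : ℤ → Fin 2 → ℂ}
    (hu : ∀ x, qw (coinOf α θ) u x = w • u x) (h0 : Jve u 0 = 0) (x : ℤ) : u x = 0 := by
  have iff0 : ∀ x, Jve u x = 0 ↔ u (x - 1) 1 = 0 ∧ u x 0 = 0 := fun x => by
    simp [Jve, funext_iff, Fin.forall_fin_two]
  have step : ∀ x, Jve u (x + 1) = 0 ↔ Jve u x = 0 := by
    intro x
    have hup := qw_eigen_up hu x
    have hdown := qw_eigen_down hu x
    have hR := rho_ne_zero (hα x)
    rw [iff0, iff0, add_sub_cancel_right]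
    constructor
    · rintro ⟨h1, h2⟩
      have h3 : u x 0 = 0 := by simpa [h1, h2, hR] using hup
      exact ⟨by simpa [h1, h3, hw] using hdown, h3⟩
    · rintro ⟨h1, h2⟩
      have h3 : u x 1 = 0 := by simpa [h1, h2, hR] using hdown
      exact ⟨h3, by simpa [h2, h3, hw] using hup⟩
  have all : ∀ x, Jve u x = 0 := by
    intro x
    induction x with
    | zero => exact h0
    | succ n ih => exact (step _).2 ih
    | pred n ih => exact (step _).1 (by rwa [sub_add_cancel])
  ext i
  fin_cases i
  · exact ((iff0 x).1 (all x)).2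
  · simpa using ((iff0 (x + 1)).1 (all (x + 1))).1

theorem exists_combination_of_det2_eq_zero {v w : Fin 2 → ℂ} (h : det2 v w = 0) :
    ∃ c d : ℂ, ¬(c = 0 ∧ d = 0) ∧ c • v + d • w = 0 := by
  simp only [det2] at h
  by_cases hv : v = 0
  · exact ⟨1, 0, by simp, by simp [hv]⟩
  by_cases h0 : v 0 = 0
  · refine ⟨w 1, -v 1, fun hc => hv ?_, ?_⟩
    · ext i; fin_cases i
      · exact h0
      · simpa using hc.2
    · ext i; fin_cases i
      · simp only [Fin.zero_eta, Pi.add_apply, Pi.smul_apply, smul_eq_mul, Pi.zero_apply]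
        linear_combination h
      · simp only [Fin.mk_one, Pi.add_apply, Pi.smul_apply, smul_eq_mul, Pi.zero_apply]
        ring
  · refine ⟨w 0, -v 0, fun hc => h0 (by simpa using hc.2), ?_⟩
    ext i; fin_cases i
    · simp only [Fin.zero_eta, Pi.add_apply, Pi.smul_apply, smul_eq_mul, Pi.zero_apply]
      ring
    · simp only [Fin.mk_one, Pi.add_apply, Pi.smul_apply, smul_eq_mul, Pi.zero_apply]
      linear_combination -h

theorem qw_combination (C : ℤ → Matrix (Fin 2) (Fin 2) ℂ) (c d : ℂ) (u v : ℤ → Fin 2 → ℂ) :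
    qw C (c • u + d • v) = c • qw C u + d • qw C v := by
  ext x i
  fin_cases i <;> simp [qw, Matrix.mulVec_add, Matrix.mulVec_smul]

/-- every eigenvalue of `U` is simple — any two `l²` eigenfunctions for the
same `w` are linearly dependent. -/
theorem stmt7 (α₀ : ℂ) (h₀ : 0 < ‖α₀‖) (h₁ : ‖α₀‖ < 1)
    (α : ℤ → ℂ) (θ : ℤ → ℝ) (hα : ∀ x : ℤ, ‖α x‖ < 1)
    (hsum : Summable fun x : ℤ => ‖α x - α₀‖ + |θ x|)
    (w : ℂ) (u₁ u₂ : ℤ → Fin 2 → ℂ)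
    (hm₁ : MemL2 u₁) (hm₂ : MemL2 u₂)
    (he₁ : ∀ x : ℤ, qw (coinOf α θ) u₁ x = w • u₁ x)
    (he₂ : ∀ x : ℤ, qw (coinOf α θ) u₂ x = w • u₂ x) :
    ∃ c₁ c₂ : ℂ, ¬(c₁ = 0 ∧ c₂ = 0) ∧ ∀ x : ℤ, c₁ • u₁ x + c₂ • u₂ x = 0 := by
  by_cases hw : w = 0
  · subst hw
    exact ⟨1, 0, by simp, fun x => by simp [qw_kernel_trivial hα he₁ x]⟩
  have hlim : Filter.Tendsto (fun x => det2 (Jve u₁ x) (Jve u₂ x)) Filter.cofinite (nhds 0) := by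
    simpa [det2] using ((hm₁.tendsto_Jve 0).mul (hm₂.tendsto_Jve 1)).sub
      ((hm₁.tendsto_Jve 1).mul (hm₂.tendsto_Jve 0))
  simp only [det2_Jve_eq hw he₁ he₂] at hlim
  obtain ⟨c, d, hcd, hc⟩ :=
    exists_combination_of_det2_eq_zero (tendsto_nhds_unique tendsto_const_nhds hlim)
  refine ⟨c, d, hcd, eq_zero_of_Jve_zero (θ := θ) (u := c • u₁ + d • u₂) hw hα (fun x => ?_) ?_⟩
  · rw [qw_combination]
    simp only [Pi.add_apply, Pi.smul_apply, he₁, he₂, smul_add, smul_comm w]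
  · rw [← hc]
    ext i
    fin_cases i <;> simp [Jve]
end
end

section
/- Assume Σ_{x∈ℤ}⟨x⟩^k(|α(x)−α₀| + |θ(x)|) < ∞ with k = 1 if U is generic and k = 2 if U is exceptional. Then the set of eigenvalues of U, i.e. {w ∈ ℂ : ∃ u ∈ l²(ℤ,ℂ²), u ≠ 0, Uu = wu}, is a finite set. -/
open Complex Matrix

noncomputable section

/-- `w` is an eigenvalue of `U` (with an `l²` eigenvector). -/
def IsEigenvalue (α : ℤ → ℂ) (θ : ℤ → ℝ) (w : ℂ) : Prop :=
  ∃ u : ℤ → Fin 2 → ℂ, (∃ x : ℤ, u x ≠ 0) ∧ MemL2 u ∧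
    ∀ x : ℤ, qw (coinOf α θ) u x = w • u x

/-- `w` is a resonance: a nonzero bounded generalized eigenfunction exists. -/
def IsResonance (α : ℤ → ℂ) (θ : ℤ → ℝ) (w : ℂ) : Prop :=
  ∃ u : ℤ → Fin 2 → ℂ, (∃ x : ℤ, u x ≠ 0) ∧ (∃ M : ℝ, ∀ x : ℤ, nrm2 (u x) ≤ M) ∧
    ∀ x : ℤ, qw (coinOf α θ) u x = w • u x

/-- `U` is generic: no edge point of the essential spectrum is a resonance. -/
def Generic (α₀ : ℂ) (α : ℤ → ℂ) (θ : ℤ → ℝ) : Prop :=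
  ∀ lam : ℝ, |Real.cos lam| = rho α₀ →
    ¬ IsResonance α θ (Complex.exp (Complex.I * (lam : ℂ)))

open scoped ComplexConjugate

lemma rho_pos {a : ℂ} (h : ‖a‖ < 1) : 0 < rho a :=
  Real.sqrt_pos.2 (by nlinarith [norm_nonneg a])

lemma rho_sq {a : ℂ} (h : ‖a‖ < 1) : rho a ^ 2 = 1 - ‖a‖ ^ 2 :=
  Real.sq_sqrt (by nlinarith [norm_nonneg a])

lemma rho_le_one (a : ℂ) : rho a ≤ 1 :=
  Real.sqrt_le_one.2 (by nlinarith [sq_nonneg ‖a‖])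

lemma abs_rho_sub_rho_le {a b : ℂ} (ha : ‖a‖ < 1) (hb : ‖b‖ < 1) :
    |rho a - rho b| ≤ 2 / rho b * ‖a - b‖ := by
  have hra := rho_pos ha
  have hrb := rho_pos hb
  have h1 : (rho a - rho b) * (rho a + rho b) = (‖b‖ - ‖a‖) * (‖b‖ + ‖a‖) := by
    linear_combination rho_sq ha - rho_sq hb
  have h2 : |rho a - rho b| * (rho a + rho b) = |‖b‖ - ‖a‖| * (‖b‖ + ‖a‖) := by
    rw [← abs_of_pos (add_pos hra hrb), ← abs_mul, h1, abs_mul,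
      abs_of_nonneg (add_nonneg (norm_nonneg b) (norm_nonneg a))]
  have h3 : |‖b‖ - ‖a‖| ≤ ‖a - b‖ := by
    rw [norm_sub_rev]
    exact abs_norm_sub_norm_le b a
  rw [div_mul_eq_mul_div, le_div_iff₀ hrb]
  nlinarith [abs_nonneg (rho a - rho b), abs_nonneg (‖b‖ - ‖a‖), norm_nonneg a, norm_nonneg b]

lemma norm_exp_ofReal_mul_I_mul_sub_le (t : ℝ) {a : ℂ} (ha : ‖a‖ ≤ 1) (b : ℂ) :
    ‖exp (t * I) * a - b‖ ≤ |t| + ‖a - b‖ := by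
  have h : exp (t * I) * a - b = (exp (I * t) - 1) * a + (a - b) := by
    rw [mul_comm I]; ring
  rw [h]
  refine (norm_add_le _ _).trans ?_
  gcongr
  rw [norm_mul]
  have h1 := Real.norm_exp_I_mul_ofReal_sub_one_le (x := t)
  rw [Real.norm_eq_abs] at h1
  nlinarith [norm_nonneg a, abs_nonneg t]

/-- The Lipschitz constant of the entries of the coin matrix near `α₀`. -/
def coinLip (α₀ : ℂ) : ℝ := 1 + 2 / rho α₀

lemma coinLip_pos {α₀ : ℂ} (h₁ : ‖α₀‖ < 1) : 0 < coinLip α₀ := by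
  have := rho_pos h₁
  unfold coinLip
  positivity

lemma norm_exp_mul_sub_le {α₀ a : ℂ} (h₁ : ‖α₀‖ < 1) (ha : ‖a‖ < 1) (t : ℝ) :
    ‖exp (t * I) * a - α₀‖ ≤ coinLip α₀ * (‖a - α₀‖ + |t|) := by
  have h := norm_exp_ofReal_mul_I_mul_sub_le t ha.le α₀
  have := rho_pos h₁
  have h2 : 0 ≤ 2 / rho α₀ * (‖a - α₀‖ + |t|) := by positivity
  unfold coinLip
  linarith

lemma norm_exp_mul_conj_sub_le {α₀ a : ℂ} (h₁ : ‖α₀‖ < 1) (ha : ‖a‖ < 1) (t : ℝ) :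
    ‖exp (t * I) * conj a - conj α₀‖ ≤ coinLip α₀ * (‖a - α₀‖ + |t|) := by
  have h := norm_exp_ofReal_mul_I_mul_sub_le t (a := conj a) (by simpa using ha.le) (conj α₀)
  rw [← map_sub, norm_conj] at h
  have := rho_pos h₁
  have h2 : 0 ≤ 2 / rho α₀ * (‖a - α₀‖ + |t|) := by positivity
  unfold coinLip
  linarith

lemma norm_exp_mul_rho_sub_le {α₀ a : ℂ} (h₁ : ‖α₀‖ < 1) (ha : ‖a‖ < 1) (t : ℝ) :
    ‖exp (t * I) * (rho a : ℂ) - (rho α₀ : ℂ)‖ ≤ coinLip α₀ * (‖a - α₀‖ + |t|) := by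
  have h := norm_exp_ofReal_mul_I_mul_sub_le t (a := (rho a : ℂ))
    (by rw [norm_real, Real.norm_of_nonneg (rho_pos ha).le]; exact rho_le_one a) (rho α₀ : ℂ)
  rw [← ofReal_sub, norm_real, Real.norm_eq_abs] at h
  have h2 := abs_rho_sub_rho_le ha h₁
  have := rho_pos h₁
  have h3 : 0 ≤ 2 / rho α₀ * |t| := by positivity
  have := norm_nonneg (a - α₀)
  unfold coinLip
  linarith

lemma qw_coinOf_add_one_zero (α : ℤ → ℂ) (θ : ℤ → ℝ) (u : ℤ → Fin 2 → ℂ) (x : ℤ) :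
    qw (coinOf α θ) u (x + 1) 0 =
      exp (θ x * I) * (rho (α x) * u x 0 + conj (α x) * u x 1) := by
  simp [qw, coinOf, coinMat, Matrix.mulVec, dotProduct, Fin.sum_univ_two]
  ring

lemma qw_coinOf_sub_one_one (α : ℤ → ℂ) (θ : ℤ → ℝ) (u : ℤ → Fin 2 → ℂ) (x : ℤ) :
    qw (coinOf α θ) u (x - 1) 1 =
      exp (θ x * I) * (-α x * u x 0 + rho (α x) * u x 1) := by
  simp [qw, coinOf, coinMat, Matrix.mulVec, dotProduct, Fin.sum_univ_two]
  ring

lemma qw_coinOf_sesq {α : ℤ → ℂ} (hα : ∀ x, ‖α x‖ < 1) (θ : ℤ → ℝ) (f g : ℤ → Fin 2 → ℂ)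
    (x : ℤ) :
    conj (qw (coinOf α θ) f (x + 1) 0) * qw (coinOf α θ) g (x + 1) 0 +
      conj (qw (coinOf α θ) f (x - 1) 1) * qw (coinOf α θ) g (x - 1) 1 =
    conj (f x 0) * g x 0 + conj (f x 1) * g x 1 := by
  have he : conj (exp (θ x * I)) * exp (θ x * I) = 1 := by
    rw [← normSq_eq_conj_mul_self, normSq_eq_norm_sq, norm_exp_ofReal_mul_I]
    simp
  have hr : (rho (α x) : ℂ) ^ 2 + conj (α x) * α x = 1 := by
    rw [← normSq_eq_conj_mul_self, normSq_eq_norm_sq, ← ofReal_pow, ← ofReal_add, rho_sq (hα x)]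
    simp
  simp only [qw_coinOf_add_one_zero, qw_coinOf_sub_one_one, map_mul, map_add, map_neg,
    conj_conj, conj_ofReal]
  linear_combination
    (conj (exp (θ x * I)) * exp (θ x * I)) * (conj (f x 0) * g x 0 + conj (f x 1) * g x 1) * hr +
    (conj (f x 0) * g x 0 + conj (f x 1) * g x 1) * he

/-- The inner product of `l²(ℤ, ℂ²)`. -/
def ip (f g : ℤ → Fin 2 → ℂ) : ℂ := ∑' x, (conj (f x 0) * g x 0 + conj (f x 1) * g x 1)

/-- The squared norm of `l²(ℤ, ℂ²)`. -/
def nsq (f : ℤ → Fin 2 → ℂ) : ℝ := ∑' x, (‖f x 0‖ ^ 2 + ‖f x 1‖ ^ 2)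

lemma ip_self (f : ℤ → Fin 2 → ℂ) : ip f f = nsq f := by
  rw [ip, nsq, ofReal_tsum]
  congr 1 with x
  simp only [← normSq_eq_conj_mul_self, normSq_eq_norm_sq, ofReal_add]

lemma MemL2.summable_norm_sq {f : ℤ → Fin 2 → ℂ} (hf : MemL2 f) (i : Fin 2) :
    Summable fun x => ‖f x i‖ ^ 2 := by
  refine hf.of_nonneg_of_le (fun x => by positivity) fun x => ?_
  fin_cases i <;> simp

lemma nsq_pos {f : ℤ → Fin 2 → ℂ} (hf : MemL2 f) (h : ∃ x, f x ≠ 0) : 0 < nsq f := by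
  obtain ⟨x, hx⟩ := h
  refine hf.tsum_pos (fun y => by positivity) x ?_
  by_contra! hle
  have h0 : f x 0 = 0 := by
    rw [← norm_eq_zero]; nlinarith [sq_nonneg ‖f x 0‖, sq_nonneg ‖f x 1‖]
  have h1 : f x 1 = 0 := by
    rw [← norm_eq_zero]; nlinarith [sq_nonneg ‖f x 0‖, sq_nonneg ‖f x 1‖]
  exact hx (by ext i; fin_cases i <;> simp [h0, h1])

lemma summable_conj_mul {ι : Type*} {f g : ι → ℂ} (hf : Summable fun x => ‖f x‖ ^ 2)
    (hg : Summable fun x => ‖g x‖ ^ 2) : Summable fun x => conj (f x) * g x := by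
  refine Summable.of_norm_bounded (hf.add hg) fun x => ?_
  rw [norm_mul, norm_conj]
  nlinarith [sq_nonneg (‖f x‖ - ‖g x‖), sq_nonneg ‖f x‖, sq_nonneg ‖g x‖]

lemma MemL2.summable_ip {f g : ℤ → Fin 2 → ℂ} (hf : MemL2 f) (hg : MemL2 g) :
    Summable fun x => conj (f x 0) * g x 0 + conj (f x 1) * g x 1 :=
  (summable_conj_mul (hf.summable_norm_sq 0) (hg.summable_norm_sq 0)).add
    (summable_conj_mul (hf.summable_norm_sq 1) (hg.summable_norm_sq 1))

lemma MemL2.zero : MemL2 0 := by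
  simp [MemL2]

lemma MemL2.add {f g : ℤ → Fin 2 → ℂ} (hf : MemL2 f) (hg : MemL2 g) : MemL2 (f + g) := by
  refine ((hf.mul_left 2).add (hg.mul_left 2)).of_nonneg_of_le (fun x => by positivity) fun x => ?_
  have key (a b : ℂ) : ‖a + b‖ ^ 2 ≤ 2 * ‖a‖ ^ 2 + 2 * ‖b‖ ^ 2 := by
    nlinarith [norm_add_le a b, norm_nonneg (a + b), sq_nonneg (‖a‖ - ‖b‖)]
  have h0 := key (f x 0) (g x 0)
  have h1 := key (f x 1) (g x 1)
  simp only [Pi.add_apply]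
  linarith

lemma MemL2.smul {f : ℤ → Fin 2 → ℂ} (hf : MemL2 f) (c : ℂ) : MemL2 (c • f) := by
  refine (hf.mul_left (‖c‖ ^ 2)).congr fun x => ?_
  simp [mul_pow]
  ring

lemma MemL2.sum {ι : Type*} (s : Finset ι) {f : ι → ℤ → Fin 2 → ℂ} (hf : ∀ i ∈ s, MemL2 (f i)) :
    MemL2 (∑ i ∈ s, f i) :=
  Finset.sum_induction f MemL2 (fun _ _ => MemL2.add) MemL2.zero hf

lemma ip_sum_smul {ι : Type*} (s : Finset ι) (c d : ι → ℂ) {f : ι → ℤ → Fin 2 → ℂ}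
    (hf : ∀ i ∈ s, MemL2 (f i)) :
    ip (∑ i ∈ s, c i • f i) (∑ j ∈ s, d j • f j) =
      ∑ i ∈ s, ∑ j ∈ s, conj (c i) * d j * ip (f i) (f j) := by
  have hs : ∀ i ∈ s, ∀ j ∈ s, Summable fun x => conj (c i) * d j *
      (conj (f i x 0) * f j x 0 + conj (f i x 1) * f j x 1) :=
    fun i hi j hj => ((hf i hi).summable_ip (hf j hj)).mul_left _
  simp only [ip, ← tsum_mul_left]
  rw [Finset.sum_congr rfl fun i hi => (Summable.tsum_finsetSum (hs i hi)).symm,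
    ← Summable.tsum_finsetSum fun i hi => summable_sum (hs i hi)]
  congr 1 with x
  simp only [Finset.sum_apply, Pi.smul_apply, smul_eq_mul, map_sum, map_mul, Finset.sum_mul_sum,
    ← Finset.sum_add_distrib]
  refine Finset.sum_congr rfl fun i _ => Finset.sum_congr rfl fun j _ => by ring

/-- The walk is unitary: eigenvectors satisfy `⟨f, g⟩ = conj w * z * ⟨f, g⟩`. -/
lemma ip_eq_of_eigen {α : ℤ → ℂ} (hα : ∀ x, ‖α x‖ < 1) {θ : ℤ → ℝ} {f g : ℤ → Fin 2 → ℂ}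
    (hf : MemL2 f) (hg : MemL2 g) {w z : ℂ} (hfw : ∀ x, qw (coinOf α θ) f x = w • f x)
    (hgz : ∀ x, qw (coinOf α θ) g x = z • g x) : ip f g = conj w * z * ip f g := by
  have h0 := summable_conj_mul (hf.summable_norm_sq 0) (hg.summable_norm_sq 0)
  have h1 := summable_conj_mul (hf.summable_norm_sq 1) (hg.summable_norm_sq 1)
  have k0 := (Equiv.addRight (1 : ℤ)).hasSum_iff.2 h0.hasSum
  have k1 := (Equiv.subRight (1 : ℤ)).hasSum_iff.2 h1.hasSum
  have key := (k0.add k1).mul_left (conj w * z)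
  have hip : ip f g = ∑' x, conj (f x 0) * g x 0 + ∑' x, conj (f x 1) * g x 1 := h0.tsum_add h1
  rw [← hip] at key
  refine (tsum_congr fun x => ?_).trans key.tsum_eq
  rw [← qw_coinOf_sesq hα θ f g x]
  simp only [hfw, hgz, Function.comp_apply, Equiv.coe_addRight, Equiv.subRight_apply,
    Pi.smul_apply, smul_eq_mul, map_mul]
  ring

lemma IsEigenvalue.norm_eq_one {α : ℤ → ℂ} (hα : ∀ x, ‖α x‖ < 1) {θ : ℤ → ℝ} {w : ℂ}
    (h : IsEigenvalue α θ w) : ‖w‖ = 1 := by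
  obtain ⟨f, hne, hf, hw⟩ := h
  have h1 := ip_eq_of_eigen hα hf hf hw hw
  have hpos := nsq_pos hf hne
  rw [ip_self, ← normSq_eq_conj_mul_self, normSq_eq_norm_sq, ← ofReal_mul, ofReal_inj] at h1
  have h2 : ‖w‖ ^ 2 = 1 := by
    apply mul_right_cancel₀ hpos.ne'
    linarith
  nlinarith [norm_nonneg w]

lemma ip_eq_zero_of_eigen {α : ℤ → ℂ} (hα : ∀ x, ‖α x‖ < 1) {θ : ℤ → ℝ} {f g : ℤ → Fin 2 → ℂ}
    (hf : MemL2 f) (hg : MemL2 g) {w z : ℂ} (hfw : ∀ x, qw (coinOf α θ) f x = w • f x)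
    (hgz : ∀ x, qw (coinOf α θ) g x = z • g x) (hw : ‖w‖ = 1) (hne : w ≠ z) : ip f g = 0 := by
  have h := ip_eq_of_eigen hα hf hg hfw hgz
  by_contra h0
  have h1 : conj w * z = 1 := by
    apply mul_right_cancel₀ h0
    rw [← h, one_mul]
  have h2 : w * conj w = 1 := by
    rw [mul_conj, normSq_eq_norm_sq, hw]; simp
  exact hne (by linear_combination (-w) * h1 + z * h2)

lemma norm_sub_sq_le_mul_sum (f : ℕ → ℂ) (n : ℕ) :
    ‖f n - f 0‖ ^ 2 ≤ n * ∑ i ∈ Finset.range n, ‖f (i + 1) - f i‖ ^ 2 := by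
  rw [← Finset.sum_range_sub]
  have h := sq_sum_le_card_mul_sum_sq (s := Finset.range n) (f := fun i => ‖f (i + 1) - f i‖)
  rw [Finset.card_range] at h
  refine le_trans ?_ h
  gcongr
  exact norm_sum_le _ _

lemma sum_range_comp_le_tsum {f : ℤ → ℝ} (hf : Summable f) (h0 : ∀ x, 0 ≤ f x) {e : ℕ → ℤ}
    (he : Function.Injective e) (n : ℕ) : ∑ i ∈ Finset.range n, f (e i) ≤ ∑' x, f x := by
  rw [← Finset.sum_image (f := f) fun _ _ _ _ h => he h]
  exact hf.sum_le_tsum _ fun _ _ => h0 _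

/-- Hardy-type bound by the Dirichlet energy for functions vanishing at the origin. -/
lemma norm_sq_le_abs_mul_tsum {p : ℤ → ℂ} (h0 : p 0 = 0)
    (hs : Summable fun x => ‖p (x + 1) - p x‖ ^ 2) (x : ℤ) :
    ‖p x‖ ^ 2 ≤ |(x : ℝ)| * ∑' y, ‖p (y + 1) - p y‖ ^ 2 := by
  obtain ⟨n, rfl | rfl⟩ := x.eq_nat_or_neg
  · have h1 := norm_sub_sq_le_mul_sum (fun i => p i) n
    have h2 := sum_range_comp_le_tsum hs (fun x => by positivity) Nat.cast_injective n
    simp only [Nat.cast_zero, h0, sub_zero, Nat.cast_add, Nat.cast_one] at h1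
    rw [Int.cast_natCast, Nat.abs_cast]
    exact h1.trans (by gcongr)
  · have h1 := norm_sub_sq_le_mul_sum (fun i => p (-i)) n
    have h2 := sum_range_comp_le_tsum hs (fun x => by positivity) (e := fun i : ℕ => -(i : ℤ) - 1)
      (fun i j h => by simpa using h) n
    simp only [Nat.cast_zero, neg_zero, h0, sub_zero] at h1
    rw [Int.cast_neg, Int.cast_natCast, abs_neg, Nat.abs_cast]
    refine h1.trans ?_
    gcongr
    refine le_of_eq_of_le (Finset.sum_congr rfl fun i _ => ?_) h2
    rw [norm_sub_rev, sub_add_cancel]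
    congr 4
    push_cast
    ring

lemma re_conj_mul_le {P Q a c : ℂ} {ε : ℝ} (h : ‖a - c‖ ≤ ε) :
    (conj P * (a * Q)).re ≤ (conj P * (c * Q)).re + ε * (‖P‖ * ‖Q‖) := by
  have h1 : (conj P * (a * Q)).re - (conj P * (c * Q)).re = ((a - c) * (conj P * Q)).re := by
    rw [← sub_re]; congr 1; ring
  have h2 := re_le_norm ((a - c) * (conj P * Q))
  rw [norm_mul, norm_mul, norm_conj] at h2
  have h3 : ‖a - c‖ * (‖P‖ * ‖Q‖) ≤ ε * (‖P‖ * ‖Q‖) := by gcongr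
  linarith

lemma re_conj_mul_ofReal_mul (P Q : ℂ) (r : ℝ) :
    (conj P * (r * Q)).re = r / 2 * (‖P‖ ^ 2 + ‖Q‖ ^ 2 - ‖P - Q‖ ^ 2) := by
  simp only [← normSq_eq_norm_sq, normSq_apply, mul_re, mul_im, conj_re, conj_im, ofReal_re,
    ofReal_im, sub_re, sub_im]
  ring

/-- Pointwise comparison of the quadratic form of the walk with that of the free walk. -/
lemma re_form_le {e a a₀ p p' q q' : ℂ} {r r₀ ε : ℝ} (hr : ‖e * r - r₀‖ ≤ ε)
    (ha : ‖e * a - a₀‖ ≤ ε) (hac : ‖e * conj a - conj a₀‖ ≤ ε) :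
    (conj p' * (e * (r * p + conj a * q)) + conj q' * (e * (-a * p + r * q))).re ≤
      r₀ / 2 * (‖p'‖ ^ 2 + ‖p‖ ^ 2 - ‖p' - p‖ ^ 2 + (‖q'‖ ^ 2 + ‖q‖ ^ 2 - ‖q' - q‖ ^ 2)) +
        ((conj a₀ * (conj p' * q)).re - (conj a₀ * (conj p * q')).re) +
        ε * (‖p'‖ ^ 2 + ‖p‖ ^ 2 + (‖q'‖ ^ 2 + ‖q‖ ^ 2)) := by
  have h1 := re_conj_mul_le (P := p') (Q := p) hr
  have h2 := re_conj_mul_le (P := p') (Q := q) hac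
  have h3 := re_conj_mul_le (P := q') (Q := -p) ha
  have h4 := re_conj_mul_le (P := q') (Q := q) hr
  rw [re_conj_mul_ofReal_mul] at h1 h4
  have hε : 0 ≤ ε := (norm_nonneg _).trans hr
  have h5 : (conj p' * (e * (r * p + conj a * q)) + conj q' * (e * (-a * p + r * q))).re =
      (conj p' * (e * r * p)).re + (conj p' * (e * conj a * q)).re +
        (conj q' * (e * a * -p)).re + (conj q' * (e * r * q)).re := by
    simp only [← add_re]; congr 1; ring
  have h6 : (conj q' * (a₀ * -p)).re = -(conj a₀ * (conj p * q')).re := by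
    simp only [mul_re, mul_im, conj_re, conj_im, neg_re, neg_im]; ring
  have h7 : (conj p' * (conj a₀ * q)).re = (conj a₀ * (conj p' * q)).re := by
    congr 1; ring
  rw [h6, norm_neg] at h3
  rw [h7] at h2
  rw [h5]
  have h8 : ‖p'‖ * ‖p‖ + ‖p'‖ * ‖q‖ + ‖q'‖ * ‖p‖ + ‖q'‖ * ‖q‖ ≤
      ‖p'‖ ^ 2 + ‖p‖ ^ 2 + (‖q'‖ ^ 2 + ‖q‖ ^ 2) := by
    nlinarith [sq_nonneg (‖p'‖ - ‖p‖), sq_nonneg (‖p'‖ - ‖q‖), sq_nonneg (‖q'‖ - ‖p‖),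
      sq_nonneg (‖q'‖ - ‖q‖)]
  have h9 := mul_le_mul_of_nonneg_left h8 hε
  linarith

lemma abs_le_jp (x : ℤ) : |(x : ℝ)| ≤ jp x :=
  Real.abs_le_sqrt (by linarith)

lemma one_le_jp (x : ℤ) : 1 ≤ jp x :=
  Real.one_le_sqrt.2 (by nlinarith [sq_nonneg (x : ℝ)])

lemma hasSum_shift_add {f : ℤ → ℝ} {s : ℝ} (h : HasSum f s) : HasSum (fun x => f (x + 1)) s :=
  (Equiv.addRight (1 : ℤ)).hasSum_iff.2 h

lemma hasSum_shift_sub {f : ℤ → ℝ} {s : ℝ} (h : HasSum f s) : HasSum (fun x => f (x - 1)) s :=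
  (Equiv.subRight (1 : ℤ)).hasSum_iff.2 h

lemma summable_norm_sub_sq {p : ℤ → ℂ} (hp : Summable fun x => ‖p x‖ ^ 2) :
    Summable fun x => ‖p (x + 1) - p x‖ ^ 2 := by
  refine (((hasSum_shift_add hp.hasSum).summable.mul_left 2).add (hp.mul_left 2)).of_nonneg_of_le
    (fun x => by positivity) fun x => ?_
  nlinarith [norm_sub_le (p (x + 1)) (p x), norm_nonneg (p (x + 1) - p x),
    sq_nonneg (‖p (x + 1)‖ - ‖p x‖)]

lemma re_ip_qw {α : ℤ → ℂ} {θ : ℤ → ℝ} {u : ℤ → Fin 2 → ℂ} (hu : MemL2 u)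
    (hqu : MemL2 (qw (coinOf α θ) u)) :
    HasSum (fun x => (conj (u (x + 1) 0) * (exp (θ x * I) *
          (rho (α x) * u x 0 + conj (α x) * u x 1)) +
        conj (u (x - 1) 1) * (exp (θ x * I) * (-α x * u x 0 + rho (α x) * u x 1))).re)
      (ip u (qw (coinOf α θ) u)).re := by
  have h0 := summable_conj_mul (hu.summable_norm_sq 0) (hqu.summable_norm_sq 0)
  have h1 := summable_conj_mul (hu.summable_norm_sq 1) (hqu.summable_norm_sq 1)
  have k := ((Equiv.addRight (1 : ℤ)).hasSum_iff.2 h0.hasSum).add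
    ((Equiv.subRight (1 : ℤ)).hasSum_iff.2 h1.hasSum)
  rw [← h0.tsum_add h1] at k
  change HasSum _ (ip u (qw (coinOf α θ) u)) at k
  simpa only [Function.comp_apply, Equiv.coe_addRight, Equiv.subRight_apply,
    qw_coinOf_add_one_zero, qw_coinOf_sub_one_one] using hasSum_re k

/-- Bargmann-type bound: the quadratic form of `Re U` does not exceed `ρ₀` on functions vanishing
on a suitable finite set. -/
lemma exists_finset_re_ip_le {α₀ : ℂ} (h₁ : ‖α₀‖ < 1) {α : ℤ → ℂ} {θ : ℤ → ℝ}
    (hα : ∀ x, ‖α x‖ < 1) (hsum : Summable fun x => jp x * (‖α x - α₀‖ + |θ x|)) :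
    ∃ S : Finset ℤ, ∀ u : ℤ → Fin 2 → ℂ, MemL2 u → MemL2 (qw (coinOf α θ) u) →
      (∀ x ∈ S, u x = 0) → (ip u (qw (coinOf α θ) u)).re ≤ rho α₀ * nsq u := by
  have hρ := rho_pos h₁
  have hK := coinLip_pos h₁
  have hη : 0 < rho α₀ / (8 * coinLip α₀) / 2 := by positivity
  obtain ⟨S, hS⟩ := ((tendsto_tsum_compl_atTop_zero
    fun x => jp x * (‖α x - α₀‖ + |θ x|)).eventually_lt_const hη).exists
  refine ⟨insert 0 (S ∪ S.image (· + 1) ∪ S.image (· - 1)), fun u hu hqu hz => ?_⟩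
  have hzS : ∀ x ∈ S, u x = 0 ∧ u (x + 1) = 0 ∧ u (x - 1) = 0 := fun x hx =>
    ⟨hz _ (by simp [hx]), hz _ (by simp [hx]), hz _ (by simp [hx])⟩
  have hz0 : u 0 = 0 := hz 0 (by simp)
  have sP := hu.summable_norm_sq 0
  have sQ := hu.summable_norm_sq 1
  have sdP := summable_norm_sub_sq sP
  have sdQ := summable_norm_sub_sq sQ
  have bP := norm_sq_le_abs_mul_tsum (p := fun x => u x 0) (by simp [hz0]) sdP
  have bQ := norm_sq_le_abs_mul_tsum (p := fun x => u x 1) (by simp [hz0]) sdQ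
  set DP := ∑' x, ‖u (x + 1) 0 - u x 0‖ ^ 2 with hDP
  set DQ := ∑' x, ‖u (x + 1) 1 - u x 1‖ ^ 2 with hDQ
  have hDP0 : 0 ≤ DP := tsum_nonneg fun x => by positivity
  have hDQ0 : 0 ≤ DQ := tsum_nonneg fun x => by positivity
  have sh : Summable fun x => (conj α₀ * (conj (u (x + 1) 0) * u x 1)).re :=
    (hasSum_re ((summable_conj_mul (f := fun x => u (x + 1) 0)
      (hasSum_shift_add sP.hasSum).summable sQ).mul_left (conj α₀)).hasSum).summable
  set tail : ℤ → ℝ := {x | x ∉ S}.indicator fun x => jp x * (‖α x - α₀‖ + |θ x|) with htail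
  have stail : Summable tail := hsum.indicator _
  have tail_lt : ∑' x, tail x < rho α₀ / (8 * coinLip α₀) / 2 := by
    rw [htail, ← tsum_subtype]; exact hS
  have total := ((((((hasSum_shift_add sP.hasSum).add sP.hasSum).sub sdP.hasSum).add
    (((hasSum_shift_sub sQ.hasSum).add sQ.hasSum).sub (hasSum_shift_sub sdQ.hasSum))).mul_left
      (rho α₀ / 2)).add (sh.hasSum.sub (hasSum_shift_sub sh.hasSum))).add
    (stail.hasSum.mul_left (coinLip α₀ * 4 * (DP + DQ)))
  have hle := hasSum_le (fun x => ?_) (re_ip_qw hu hqu) total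
  · refine hle.trans ?_
    have hn : nsq u = ∑' x, ‖u x 0‖ ^ 2 + ∑' x, ‖u x 1‖ ^ 2 := sP.tsum_add sQ
    have h4 : coinLip α₀ * 4 * (DP + DQ) * ∑' x, tail x ≤
        coinLip α₀ * 4 * (DP + DQ) * (rho α₀ / (8 * coinLip α₀)) := by
      gcongr
      linarith
    have h5 : coinLip α₀ * 4 * (DP + DQ) * (rho α₀ / (8 * coinLip α₀)) =
        rho α₀ / 2 * (DP + DQ) := by
      field_simp
      ring
    rw [hn]
    linarith
  · refine (re_form_le (norm_exp_mul_rho_sub_le h₁ (hα x) (θ x))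
      (norm_exp_mul_sub_le h₁ (hα x) (θ x)) (norm_exp_mul_conj_sub_le h₁ (hα x) (θ x))).trans ?_
    simp only [sub_add_cancel]
    rw [norm_sub_rev (u (x - 1) 1) (u x 1)]
    refine add_le_add le_rfl ?_
    by_cases hx : x ∈ S
    · obtain ⟨e1, e2, e3⟩ := hzS x hx
      simp [e1, e2, e3, htail, hx]
    · have hxt : tail x = jp x * (‖α x - α₀‖ + |θ x|) := by simp [htail, hx]
      have hj1 := abs_le_jp x
      have hj2 := one_le_jp x
      have c1 : |((x + 1 : ℤ) : ℝ)| ≤ 2 * jp x := by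
        push_cast
        refine (abs_add_le _ _).trans ?_
        rw [abs_one]; linarith
      have c2 : |((x - 1 : ℤ) : ℝ)| ≤ 2 * jp x := by
        push_cast
        refine (abs_sub _ _).trans ?_
        rw [abs_one]; linarith
      have c0 : |(x : ℝ)| ≤ 2 * jp x := by linarith
      have d1 := (bP (x + 1)).trans (mul_le_mul_of_nonneg_right c1 hDP0)
      have d2 := (bP x).trans (mul_le_mul_of_nonneg_right c0 hDP0)
      have d3 := (bQ (x - 1)).trans (mul_le_mul_of_nonneg_right c2 hDQ0)
      have d4 := (bQ x).trans (mul_le_mul_of_nonneg_right c0 hDQ0)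
      have hδ : 0 ≤ coinLip α₀ * (‖α x - α₀‖ + |θ x|) := by positivity
      have := mul_le_mul_of_nonneg_left (add_le_add (add_le_add d1 d2) (add_le_add d3 d4)) hδ
      refine this.trans (le_of_eq ?_)
      rw [hxt]
      ring

lemma finite_eigenvalues_re_gt {α₀ : ℂ} (h₁ : ‖α₀‖ < 1) {α : ℤ → ℂ} {θ : ℤ → ℝ}
    (hα : ∀ x, ‖α x‖ < 1) (hsum : Summable fun x => jp x * (‖α x - α₀‖ + |θ x|)) :
    {w : ℂ | IsEigenvalue α θ w ∧ rho α₀ < w.re}.Finite := by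
  by_contra hinf
  obtain ⟨S, hS⟩ := exists_finset_re_ip_le h₁ hα hsum
  obtain ⟨t, ht, hcard⟩ := Set.Infinite.exists_subset_card_eq hinf (2 * S.card + 1)
  have hex : ∀ w : t, IsEigenvalue α θ w := fun w => (ht w.2).1
  choose f hne hf hw using hex
  let L : (t → ℂ) →ₗ[ℂ] (S → Fin 2 → ℂ) :=
    LinearMap.pi fun x => Fintype.linearCombination ℂ fun w : t => f w x
  have hker : LinearMap.ker L ≠ ⊥ := by
    apply LinearMap.ker_ne_bot_of_finrank_lt
    simp [Module.finrank_pi_fintype, hcard]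
    lia
  obtain ⟨c, hc, hc0⟩ := Submodule.exists_mem_ne_zero_of_ne_bot hker
  set u : ℤ → Fin 2 → ℂ := ∑ w : t, c w • f w with hu
  have hquw : qw (coinOf α θ) u = ∑ w : t, (c w * w) • f w := by
    have hadd (x : ℤ) (i : Fin 2) :
        qw (coinOf α θ) u x i = ∑ w : t, c w * qw (coinOf α θ) (f w) x i := by
      fin_cases i <;>
        simp [qw, hu, Finset.sum_apply, Matrix.mulVec_sum, Matrix.mulVec_smul]
    ext x i
    rw [hadd]
    simp [hw, Finset.sum_apply, mul_assoc]
  have huL : MemL2 u := MemL2.sum _ fun w _ => (hf w).smul _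
  have hquL : MemL2 (qw (coinOf α θ) u) := by
    rw [hquw]; exact MemL2.sum _ fun w _ => (hf w).smul _
  have huz : ∀ x ∈ S, u x = 0 := fun x hx => by
    have := congrFun (LinearMap.mem_ker.1 hc) ⟨x, hx⟩
    simpa [L, Fintype.linearCombination_apply, hu, Finset.sum_apply] using this
  have hle := hS u huL hquL huz
  have horth (d : t → ℂ) : ip u (∑ w : t, d w • f w) =
      ∑ w : t, conj (c w) * d w * nsq (f w) := by
    rw [hu, ip_sum_smul _ _ _ fun w _ => hf w]
    refine Finset.sum_congr rfl fun w _ => ?_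
    rw [Finset.sum_eq_single w, ip_self]
    · intro z _ hzw
      rw [ip_eq_zero_of_eigen hα (hf w) (hf z) (hw w) (hw z)
        ((ht w.2).1.norm_eq_one hα) fun h => hzw (Subtype.ext h.symm), mul_zero]
    · simp
  have hnsq : nsq u = ∑ w : t, ‖c w‖ ^ 2 * nsq (f w) := by
    have h := horth c
    rw [← hu, ip_self] at h
    have h' := congrArg re h
    rw [ofReal_re, re_sum] at h'
    rw [h']
    refine Finset.sum_congr rfl fun w _ => ?_
    rw [← normSq_eq_conj_mul_self, normSq_eq_norm_sq, ← ofReal_mul, ofReal_re]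
  rw [hquw, horth, re_sum, hnsq, Finset.mul_sum] at hle
  refine absurd hle (not_le.2 ?_)
  obtain ⟨z, hz⟩ := Function.ne_iff.1 hc0
  have hterm (w : t) : (conj (c w) * (c w * w) * (nsq (f w) : ℂ)).re =
      w.1.re * (‖c w‖ ^ 2 * nsq (f w)) := by
    rw [← mul_assoc, ← normSq_eq_conj_mul_self, normSq_eq_norm_sq, re_mul_ofReal, re_ofReal_mul]
    ring
  refine Finset.sum_lt_sum (fun w _ => ?_) ⟨z, Finset.mem_univ z, ?_⟩
  · rw [hterm]
    have := nsq_pos (hf w) (hne w)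
    have := (ht w.2).2
    gcongr
  · rw [hterm]
    have := nsq_pos (hf z) (hne z)
    have := (ht z.2).2
    have : 0 < ‖c z‖ := norm_pos_iff.2 hz
    gcongr

/-- Conjugation by `(-1)^x` turns `U` into `-U`. -/
lemma IsEigenvalue.neg {α : ℤ → ℂ} {θ : ℤ → ℝ} {w : ℂ} (h : IsEigenvalue α θ w) :
    IsEigenvalue α θ (-w) := by
  obtain ⟨u, ⟨x₀, hx₀⟩, hu, hw⟩ := h
  have hs (x : ℤ) : (-1 : ℂ) ^ x ≠ 0 := zpow_ne_zero _ (by simp)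
  refine ⟨fun x => (-1 : ℂ) ^ x • u x, ⟨x₀, smul_ne_zero (hs x₀) hx₀⟩, ?_, fun x => ?_⟩
  · refine hu.congr fun x => ?_
    simp
  · have h1 : (-1 : ℂ) ^ (x + 1) = -(-1 : ℂ) ^ x := by
      rw [zpow_add_one₀ (by simp)]; ring
    have h2 : (-1 : ℂ) ^ (x - 1) = -(-1 : ℂ) ^ x := by
      rw [zpow_sub_one₀ (by simp)]; norm_num
    have h3 : qw (coinOf α θ) (fun x => (-1 : ℂ) ^ x • u x) x =
        (-(-1 : ℂ) ^ x) • qw (coinOf α θ) u x := by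
      ext i
      fin_cases i <;> simp [qw, h1, h2, Matrix.mulVec_neg, Matrix.mulVec_smul]
    rw [h3, hw, smul_smul, smul_smul]
    congr 1
    ring

/-- A sequence tending to zero, controlled by an almost conserved definite quantity, vanishes
eventually. -/
lemma exists_forall_ge_eq_zero_of_almost_conserved {N Q ε : ℕ → ℝ} {c C : ℝ}
    (hN : ∀ n, 0 ≤ N n) (hc : 0 < c) (hcQ : ∀ n, c * N n ≤ |Q n|) (hQC : ∀ n, |Q n| ≤ C * N n)
    (hQ : ∀ n, |Q (n + 1) - Q n| ≤ ε n * (N n + N (n + 1))) (hε : ∀ n, 0 ≤ ε n)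
    (hεs : Summable ε) (hN0 : Filter.Tendsto N Filter.atTop (nhds 0)) :
    ∃ M, ∀ n ≥ M, N n = 0 := by
  obtain ⟨M, hM⟩ := Filter.eventually_atTop.1
    ((tendsto_sum_nat_add ε).eventually_lt_const (show 0 < c / 4 by positivity))
  refine ⟨M, ?_⟩
  have hbdd : BddAbove (Set.range fun k => N (k + M)) :=
    ((Filter.tendsto_add_atTop_iff_nat M).2 hN0).bddAbove_range
  set B := ⨆ k, N (k + M) with hB
  have hNB : ∀ n ≥ M, N n ≤ B := fun n hn => by
    have := le_ciSup hbdd (n - M)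
    simpa [Nat.sub_add_cancel hn] using this
  have hB0 : 0 ≤ B := (hN M).trans (hNB M le_rfl)
  have hQ0 : Filter.Tendsto (fun n => |Q n|) Filter.atTop (nhds 0) :=
    squeeze_zero (fun n => abs_nonneg _) hQC (by simpa using hN0.const_mul C)
  have hhalf : ∀ n ≥ M, N n ≤ B / 2 := fun n hn => by
    have hstep (m : ℕ) : c * N n ≤ |Q (m + n)| + c / 4 * (2 * B) := by
      have htel : |Q (m + n) - Q n| ≤ c / 4 * (2 * B) := by
        have h := Finset.sum_range_sub (fun i => Q (i + n)) m
        rw [zero_add] at h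
        rw [← h]
        refine (Finset.abs_sum_le_sum_abs _ _).trans ?_
        have h2 : ∀ i ∈ Finset.range m, |Q (i + 1 + n) - Q (i + n)| ≤ ε (i + n) * (2 * B) :=
          fun i _ => by
            rw [add_right_comm]
            refine (hQ _).trans (mul_le_mul_of_nonneg_left ?_ (hε _))
            linarith [hNB (i + n) (by lia), hNB (i + n + 1) (by lia)]
        refine (Finset.sum_le_sum h2).trans ?_
        rw [← Finset.sum_mul]
        refine mul_le_mul_of_nonneg_right ?_ (by positivity)
        exact (((summable_nat_add_iff n).2 hεs).sum_le_tsum _ fun i _ => hε _).trans (hM n hn).le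
      have h1 := hcQ n
      have h2 := abs_sub_abs_le_abs_sub (Q n) (Q (m + n))
      rw [abs_sub_comm] at h2
      linarith
    have hlim := ((Filter.tendsto_add_atTop_iff_nat n).2 hQ0).add_const (c / 4 * (2 * B))
    have := ge_of_tendsto' hlim hstep
    have h3 : c * N n ≤ c * (B / 2) := by linarith
    exact le_of_mul_le_mul_left h3 hc
  have hBhalf : B ≤ B / 2 := ciSup_le fun k => hhalf _ (by lia)
  intro n hn
  linarith [hN n, hNB n hn]

/-- The quadratic form preserved by the free transfer matrix at spectral parameter `w`, where
`s = Im w`. -/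
def ellipticForm (α₀ : ℂ) (s : ℝ) (a b : ℂ) : ℝ :=
  s * (‖a‖ ^ 2 + ‖b‖ ^ 2) + 2 * (α₀ * (conj a * b)).im

lemma abs_im_mul_conj_mul_le (α₀ a b : ℂ) : |(α₀ * (conj a * b)).im| ≤ ‖α₀‖ * (‖a‖ * ‖b‖) := by
  simpa using abs_im_le_norm (α₀ * (conj a * b))

lemma abs_ellipticForm_le {α₀ : ℂ} (h₁ : ‖α₀‖ < 1) {s : ℝ} (hs : |s| ≤ 1) (a b : ℂ) :
    |ellipticForm α₀ s a b| ≤ 2 * (‖a‖ ^ 2 + ‖b‖ ^ 2) := by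
  have h := abs_im_mul_conj_mul_le α₀ a b
  have h2 : ‖α₀‖ * (‖a‖ * ‖b‖) ≤ 1 * (‖a‖ * ‖b‖) := by gcongr
  have h3 : |s| * (‖a‖ ^ 2 + ‖b‖ ^ 2) ≤ 1 * (‖a‖ ^ 2 + ‖b‖ ^ 2) := by gcongr
  rw [ellipticForm]
  refine (abs_add_le _ _).trans ?_
  rw [abs_mul, abs_mul, abs_two, abs_of_nonneg (a := ‖a‖ ^ 2 + ‖b‖ ^ 2) (by positivity)]
  nlinarith [sq_nonneg (‖a‖ - ‖b‖)]

lemma le_abs_ellipticForm (α₀ : ℂ) (s : ℝ) (a b : ℂ) :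
    (|s| - ‖α₀‖) * (‖a‖ ^ 2 + ‖b‖ ^ 2) ≤ |ellipticForm α₀ s a b| := by
  have h := abs_im_mul_conj_mul_le α₀ a b
  have h2 : |s| * (‖a‖ ^ 2 + ‖b‖ ^ 2) ≤
      |ellipticForm α₀ s a b| + 2 * |(α₀ * (conj a * b)).im| := by
    rw [← abs_of_nonneg (a := ‖a‖ ^ 2 + ‖b‖ ^ 2) (by positivity), ← abs_mul, ← abs_two,
      ← abs_mul]
    have := abs_sub (ellipticForm α₀ s a b) (2 * (α₀ * (conj a * b)).im)
    rwa [ellipticForm, add_sub_cancel_right, ← ellipticForm] at this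
  nlinarith [mul_nonneg (norm_nonneg α₀) (sq_nonneg (‖a‖ - ‖b‖))]

lemma abs_norm_sq_sub_norm_sq_le (a b : ℂ) : |‖a‖ ^ 2 - ‖b‖ ^ 2| ≤ ‖a - b‖ * (‖a‖ + ‖b‖) := by
  rw [show ‖a‖ ^ 2 - ‖b‖ ^ 2 = (‖a‖ - ‖b‖) * (‖a‖ + ‖b‖) by ring, abs_mul,
    abs_of_nonneg (a := ‖a‖ + ‖b‖) (by positivity)]
  gcongr
  exact abs_norm_sub_norm_le a b

lemma abs_ellipticForm_sub_right_le {α₀ : ℂ} (h₁ : ‖α₀‖ < 1) {s : ℝ} (hs : |s| ≤ 1) (a b c : ℂ) :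
    |ellipticForm α₀ s a b - ellipticForm α₀ s a c| ≤ ‖b - c‖ * (‖b‖ + ‖c‖ + 2 * ‖a‖) := by
  have h1 : ellipticForm α₀ s a b - ellipticForm α₀ s a c =
      s * (‖b‖ ^ 2 - ‖c‖ ^ 2) + 2 * (α₀ * (conj a * (b - c))).im := by
    simp only [ellipticForm, mul_sub, sub_im]; ring
  have h := abs_im_mul_conj_mul_le α₀ a (b - c)
  have h2 : ‖α₀‖ * (‖a‖ * ‖b - c‖) ≤ 1 * (‖a‖ * ‖b - c‖) := by gcongr
  have h3 : |s| * |‖b‖ ^ 2 - ‖c‖ ^ 2| ≤ 1 * (‖b - c‖ * (‖b‖ + ‖c‖)) := by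
    gcongr; exact abs_norm_sq_sub_norm_sq_le b c
  rw [h1]
  refine (abs_add_le _ _).trans ?_
  rw [abs_mul, abs_mul, abs_two]
  linarith

lemma abs_ellipticForm_sub_left_le {α₀ : ℂ} (h₁ : ‖α₀‖ < 1) {s : ℝ} (hs : |s| ≤ 1) (a b c : ℂ) :
    |ellipticForm α₀ s a c - ellipticForm α₀ s b c| ≤ ‖a - b‖ * (‖a‖ + ‖b‖ + 2 * ‖c‖) := by
  have h1 : ellipticForm α₀ s a c - ellipticForm α₀ s b c =
      s * (‖a‖ ^ 2 - ‖b‖ ^ 2) + 2 * (α₀ * (conj (a - b) * c)).im := by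
    simp only [ellipticForm, map_sub, sub_mul, mul_sub, sub_im]; ring
  have h := abs_im_mul_conj_mul_le α₀ (a - b) c
  have h2 : ‖α₀‖ * (‖a - b‖ * ‖c‖) ≤ 1 * (‖a - b‖ * ‖c‖) := by gcongr
  have h3 : |s| * |‖a‖ ^ 2 - ‖b‖ ^ 2| ≤ 1 * (‖a - b‖ * (‖a‖ + ‖b‖)) := by
    gcongr; exact abs_norm_sq_sub_norm_sq_le a b
  rw [h1]
  refine (abs_add_le _ _).trans ?_
  rw [abs_mul, abs_mul, abs_two]
  linarith

/-- The free transfer matrix preserves `ellipticForm`. -/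
lemma ellipticForm_free {α₀ : ℂ} (h₁ : ‖α₀‖ < 1) {w : ℂ} (hw : ‖w‖ = 1) (a' b : ℂ) :
    ellipticForm α₀ w.im a' (conj w * (rho α₀ * b + conj α₀ * a')) =
      ellipticForm α₀ w.im (conj w * (rho α₀ * a' - α₀ * b)) b := by
  have hr := rho_sq h₁
  simp only [ellipticForm, norm_mul, norm_conj, hw, one_mul]
  simp only [← normSq_eq_norm_sq, normSq_apply] at hr ⊢
  simp only [mul_re, mul_im, conj_re, conj_im, ofReal_re, ofReal_im, sub_re, sub_im, add_re,
    add_im]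
  linear_combination (w.im * (b.re ^ 2 + b.im ^ 2) - w.im * (a'.re ^ 2 + a'.im ^ 2)) * hr

lemma abs_ellipticForm_step_le {α₀ : ℂ} (h₁ : ‖α₀‖ < 1) {w : ℂ} (hw : ‖w‖ = 1)
    {e α a b a' b' : ℂ} {r ε : ℝ} (hr : ‖e * r - rho α₀‖ ≤ ε)
    (hα : ‖e * α - α₀‖ ≤ ε) (hαc : ‖e * conj α - conj α₀‖ ≤ ε)
    (ha : e * (-α * b + r * a') = w * a) (hb : e * (r * b + conj α * a') = w * b') :
    |ellipticForm α₀ w.im a' b' - ellipticForm α₀ w.im a b| ≤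
      9 * ε * (‖a‖ ^ 2 + ‖b‖ ^ 2 + (‖a'‖ ^ 2 + ‖b'‖ ^ 2)) := by
  have hε : 0 ≤ ε := (norm_nonneg _).trans hr
  have hs : |w.im| ≤ 1 := hw ▸ abs_im_le_norm w
  have hww : w * conj w = 1 := by rw [mul_conj, normSq_eq_norm_sq, hw]; simp
  have hρ : ‖(rho α₀ : ℂ)‖ ≤ 1 := by
    rw [norm_real, Real.norm_of_nonneg (rho_pos h₁).le]; exact rho_le_one α₀
  have hfree := ellipticForm_free h₁ hw a' b
  set A := conj w * (rho α₀ * a' - α₀ * b) with hA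
  set B := conj w * (rho α₀ * b + conj α₀ * a') with hB
  have hAn : ‖A‖ ≤ ‖a'‖ + ‖b‖ := by
    rw [hA, norm_mul, norm_conj, hw, one_mul]
    refine (norm_sub_le _ _).trans ?_
    rw [norm_mul, norm_mul]
    nlinarith [norm_nonneg a', norm_nonneg b]
  have hBn : ‖B‖ ≤ ‖a'‖ + ‖b‖ := by
    rw [hB, norm_mul, norm_conj, hw, one_mul]
    refine (norm_add_le _ _).trans ?_
    rw [norm_mul, norm_mul, norm_conj]
    nlinarith [norm_nonneg a', norm_nonneg b]
  have hbB : ‖b' - B‖ ≤ ε * (‖a'‖ + ‖b‖) := by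
    have h : w * (b' - B) = (e * r - rho α₀) * b + (e * conj α - conj α₀) * a' := by
      rw [mul_sub, ← hb, hB, ← mul_assoc w, hww]; ring
    rw [← one_mul ‖b' - B‖, ← hw, ← norm_mul, h]
    refine (norm_add_le _ _).trans ?_
    rw [norm_mul, norm_mul]
    nlinarith [norm_nonneg a', norm_nonneg b]
  have haA : ‖a - A‖ ≤ ε * (‖a'‖ + ‖b‖) := by
    have h : w * (a - A) = (e * r - rho α₀) * a' - (e * α - α₀) * b := by
      rw [mul_sub, ← ha, hA, ← mul_assoc w, hww]; ring
    rw [← one_mul ‖a - A‖, ← hw, ← norm_mul, h]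
    refine (norm_sub_le _ _).trans ?_
    rw [norm_mul, norm_mul]
    nlinarith [norm_nonneg a', norm_nonneg b]
  have h1 := abs_ellipticForm_sub_right_le h₁ hs a' b' B
  have h2 := abs_ellipticForm_sub_left_le h₁ hs a A b
  have h3 : ‖b' - B‖ * (‖b'‖ + ‖B‖ + 2 * ‖a'‖) ≤
      ε * (‖a'‖ + ‖b‖) * (‖b'‖ + (‖a'‖ + ‖b‖) + 2 * ‖a'‖) := by gcongr
  have h4 : ‖a - A‖ * (‖a‖ + ‖A‖ + 2 * ‖b‖) ≤
      ε * (‖a'‖ + ‖b‖) * (‖a‖ + (‖a'‖ + ‖b‖) + 2 * ‖b‖) := by gcongr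
  have h5 : (‖a'‖ + ‖b‖) * (‖b'‖ + ‖a‖ + 4 * (‖a'‖ + ‖b‖)) ≤
      9 * (‖a‖ ^ 2 + ‖b‖ ^ 2 + (‖a'‖ ^ 2 + ‖b'‖ ^ 2)) := by
    nlinarith [sq_nonneg (‖a'‖ - ‖b‖), sq_nonneg (‖a'‖ + ‖b‖ - ‖b'‖ - ‖a‖),
      sq_nonneg (‖b'‖ - ‖a‖)]
  have h6 := mul_le_mul_of_nonneg_left h5 hε
  have h7 : ellipticForm α₀ w.im a' b' - ellipticForm α₀ w.im a b =
      (ellipticForm α₀ w.im a' b' - ellipticForm α₀ w.im a' B) -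
        (ellipticForm α₀ w.im a b - ellipticForm α₀ w.im A b) := by
    rw [hfree]; ring
  rw [h7]
  refine (abs_sub _ _).trans ?_
  linarith

/-- There are no eigenvalues in the interior of the essential spectrum. -/
lemma IsEigenvalue.rho_le_abs_re {α₀ : ℂ} (h₁ : ‖α₀‖ < 1) {α : ℤ → ℂ} {θ : ℤ → ℝ}
    (hα : ∀ x, ‖α x‖ < 1) (hsum : Summable fun x => ‖α x - α₀‖ + |θ x|) {w : ℂ}
    (h : IsEigenvalue α θ w) : rho α₀ ≤ |w.re| := by
  by_contra! hlt
  have hw := h.norm_eq_one hα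
  obtain ⟨u, ⟨x₀, hx₀⟩, hu, huw⟩ := h
  have hs : |w.im| ≤ 1 := hw ▸ abs_im_le_norm w
  have hc : 0 < |w.im| - ‖α₀‖ := by
    have e1 : |w.re| ^ 2 + |w.im| ^ 2 = 1 := by
      have := normSq_eq_norm_sq w
      rw [normSq_apply, hw] at this
      rw [sq_abs, sq_abs]; linarith
    have e2 := rho_sq h₁
    rw [sub_pos]
    refine lt_of_pow_lt_pow_left₀ 2 (abs_nonneg _) ?_
    nlinarith [abs_nonneg w.re]
  have ha (x : ℤ) : exp (θ x * I) * (-α x * u x 0 + rho (α x) * u x 1) = w * u (x - 1) 1 := by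
    rw [← qw_coinOf_sub_one_one, huw]; rfl
  have hb (x : ℤ) :
      exp (θ x * I) * (rho (α x) * u x 0 + conj (α x) * u x 1) = w * u (x + 1) 0 := by
    rw [← qw_coinOf_add_one_zero, huw]; rfl
  have hsN : Summable fun x => ‖u (x - 1) 1‖ ^ 2 + ‖u x 0‖ ^ 2 :=
    (hasSum_shift_sub (hu.summable_norm_sq 1).hasSum).summable.add (hu.summable_norm_sq 0)
  obtain ⟨M, hM⟩ := exists_forall_ge_eq_zero_of_almost_conserved
    (N := fun n => ‖u ((n : ℤ) - 1) 1‖ ^ 2 + ‖u n 0‖ ^ 2)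
    (Q := fun n => ellipticForm α₀ w.im (u ((n : ℤ) - 1) 1) (u n 0))
    (ε := fun n => 9 * (coinLip α₀ * (‖α n - α₀‖ + |θ n|)))
    (fun n => by positivity) hc (fun n => le_abs_ellipticForm _ _ _ _)
    (fun n => abs_ellipticForm_le h₁ hs _ _)
    (fun n => by
      have := abs_ellipticForm_step_le h₁ hw (norm_exp_mul_rho_sub_le h₁ (hα n) (θ n))
        (norm_exp_mul_sub_le h₁ (hα n) (θ n)) (norm_exp_mul_conj_sub_le h₁ (hα n) (θ n))
        (ha n) (hb n)
      simpa only [Nat.cast_add, Nat.cast_one, add_sub_cancel_right] using this)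
    (fun n => by have := coinLip_pos h₁; positivity)
    (((hsum.comp_injective Nat.cast_injective).mul_left _).mul_left _)
    (hsN.comp_injective Nat.cast_injective).tendsto_atTop_zero
  have hzero (n : ℤ) (hn : ‖u (n - 1) 1‖ ^ 2 + ‖u n 0‖ ^ 2 = 0) : u (n - 1) 1 = 0 ∧ u n 0 = 0 := by
    constructor <;> rw [← norm_eq_zero] <;>
      nlinarith [sq_nonneg ‖u (n - 1) 1‖, sq_nonneg ‖u n 0‖]
  have hge : ∀ n : ℤ, M ≤ n → u (n - 1) 1 = 0 ∧ u n 0 = 0 := fun n hn => by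
    lift n to ℕ using by lia
    exact hzero n (hM n (by lia))
  have hle : ∀ n : ℤ, n ≤ M → u (n - 1) 1 = 0 ∧ u n 0 = 0 := fun n hn => by
    induction n, hn using Int.leInductionDown with
    | base => exact hge M le_rfl
    | pred n _ ih =>
      have hw0 : w ≠ 0 := by
        rintro rfl
        simp at hw
      have hρ : (rho (α (n - 1)) : ℂ) ≠ 0 := ofReal_ne_zero.2 (rho_pos (hα _)).ne'
      have e1 := hb (n - 1)
      have e2 := ha (n - 1)
      rw [sub_add_cancel, ih.1, ih.2] at e1
      have e3 : u (n - 1) 0 = 0 := by simpa [exp_ne_zero, hρ] using e1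
      rw [ih.1, e3] at e2
      exact ⟨by simpa [hw0] using e2.symm, e3⟩
  have hall (n : ℤ) : u (n - 1) 1 = 0 ∧ u n 0 = 0 := (le_total n M).elim (hle n) (hge n)
  refine hx₀ ?_
  have e1 := (hall (x₀ + 1)).1
  rw [add_sub_cancel_right] at e1
  ext i
  fin_cases i
  · exact (hall x₀).2
  · exact e1

lemma finite_unit_abs_re_eq (r : ℝ) : {w : ℂ | ‖w‖ = 1 ∧ |w.re| = r}.Finite := by
  refine Set.Finite.subset (Set.Finite.image (fun z : ℝ × ℝ => (⟨z.1, z.2⟩ : ℂ))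
    (Set.Finite.prod (Set.toFinite {r, -r})
      (Set.toFinite {Real.sqrt (1 - r ^ 2), -Real.sqrt (1 - r ^ 2)}))) ?_
  rintro w ⟨hw, hr⟩
  refine ⟨(w.re, w.im), ⟨?_, ?_⟩, rfl⟩
  · rcases abs_choice w.re with h | h <;> simp [← hr, h]
  · have : w.im ^ 2 = 1 - r ^ 2 := by
      have := normSq_eq_norm_sq w
      rw [normSq_apply, hw] at this
      rw [← hr, sq_abs]; linarith
    rw [← this, Real.sqrt_sq_eq_abs]
    rcases abs_choice w.im with h | h <;> simp [h]

/-- under an `l^{1,k}` perturbation (`k = 1` generic, `k = 2` exceptional),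
the set of eigenvalues of `U` is finite. -/
theorem stmt8 (α₀ : ℂ) (h₀ : 0 < ‖α₀‖) (h₁ : ‖α₀‖ < 1)
    (α : ℤ → ℂ) (θ : ℤ → ℝ) (hα : ∀ x : ℤ, ‖α x‖ < 1)
    (hsum :
      (Generic α₀ α θ ∧ Summable fun x : ℤ => jp x * (‖α x - α₀‖ + |θ x|)) ∨
      (¬ Generic α₀ α θ ∧ Summable fun x : ℤ => jp x ^ 2 * (‖α x - α₀‖ + |θ x|))) :
    Set.Finite {w : ℂ | IsEigenvalue α θ w} := by
  have hsum1 : Summable fun x : ℤ => jp x * (‖α x - α₀‖ + |θ x|) := by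
    rcases hsum with h | h
    · exact h.2
    · refine h.2.of_nonneg_of_le (fun x => ?_) fun x => ?_ <;> have hj := one_le_jp x
      · positivity
      · gcongr
        exact le_self_pow₀ hj two_ne_zero
  have hsum0 : Summable fun x : ℤ => ‖α x - α₀‖ + |θ x| :=
    hsum1.of_nonneg_of_le (fun x => by positivity)
      fun x => le_mul_of_one_le_left (by positivity) (one_le_jp x)
  have hfin := finite_eigenvalues_re_gt h₁ hα hsum1
  refine ((hfin.union (hfin.image Neg.neg)).union (finite_unit_abs_re_eq (rho α₀))).subset ?_
  intro w hw
  rcases (hw.rho_le_abs_re h₁ hα hsum0).eq_or_lt with h | h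
  · exact Or.inr ⟨hw.norm_eq_one hα, h.symm⟩
  · rcases lt_abs.1 h with h | h
    · exact Or.inl (Or.inl ⟨hw, h⟩)
    · exact Or.inl (Or.inr ⟨-w, ⟨hw.neg, by simpa using h⟩, neg_neg w⟩)
end
end

section
/- Let 0 < ρ₀ < 1 and let Ω := {λ ∈ ℂ : ρ₀⁻¹·cos λ ∉ [−1,1]}. For every λ ∈ Ω there exists a unique ξ ∈ ℂ with Im ξ > 0, −π < Re ξ ≤ π, and cos ξ = ρ₀⁻¹·cos λ. Moreover, for every λ₀ ∈ Ω there exist an open neighborhood V ⊆ Ω of λ₀ and a holomorphic function ξ : V → {z ∈ ℂ : Im z > 0} with cos(ξ(λ)) = ρ₀⁻¹·cos λ for all λ ∈ V. -/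
open Complex

lemma Complex.im_ne_zero_of_cos_notMem {z : ℂ}
    (h : Complex.cos z ∉ Complex.ofReal '' Set.Icc (-1 : ℝ) 1) : z.im ≠ 0 := by
  intro hz
  have hre : z = (z.re : ℂ) := Complex.ext rfl (by simp [hz])
  refine h ⟨Real.cos z.re, ⟨Real.neg_one_le_cos _, Real.cos_le_one _⟩, ?_⟩
  rw [Complex.ofReal_cos, ← hre]

lemma Complex.exists_im_pos_cos_eq {w : ℂ}
    (hw : w ∉ Complex.ofReal '' Set.Icc (-1 : ℝ) 1) : ∃ z : ℂ, 0 < z.im ∧ Complex.cos z = w := by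
  obtain ⟨z, rfl⟩ := Complex.cos_surjective w
  rcases (Complex.im_ne_zero_of_cos_notMem hw).lt_or_gt with h | h
  · exact ⟨-z, by simpa using h, Complex.cos_neg z⟩
  · exact ⟨z, h, rfl⟩

/-- Outside `[-1, 1]`, the complex cosine has exactly one preimage in the upper half-strip
`{z | 0 < im z, -π < re z ≤ π}`. -/
lemma Complex.existsUnique_cos_eq {w : ℂ}
    (hw : w ∉ Complex.ofReal '' Set.Icc (-1 : ℝ) 1) :
    ∃! z : ℂ, 0 < z.im ∧ -Real.pi < z.re ∧ z.re ≤ Real.pi ∧ Complex.cos z = w := by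
  obtain ⟨z, hz, rfl⟩ := Complex.exists_im_pos_cos_eq hw
  obtain ⟨n, ⟨hn₁, hn₂⟩, -⟩ := existsUnique_add_zsmul_mem_Ioc Real.two_pi_pos z.re (-Real.pi)
  rw [zsmul_eq_mul] at hn₁ hn₂
  refine ⟨z + n * (2 * Real.pi), ⟨by simpa using hz, by simpa using hn₁, ?_,
    Complex.cos_add_int_mul_two_pi z n⟩, ?_⟩
  · have : (z + n * (2 * Real.pi)).re = z.re + n * (2 * Real.pi) := by simp
    linarith
  rintro y ⟨hy, hy₁, hy₂, hyz⟩
  rw [← Complex.cos_add_int_mul_two_pi z n] at hyz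
  set x : ℂ := z + n * (2 * Real.pi) with hx
  have hxre : x.re = z.re + n * (2 * Real.pi) := by simp [hx]
  have hxim : 0 < x.im := by simpa [hx] using hz
  obtain ⟨k, hk | hk⟩ := Complex.cos_eq_cos_iff.1 hyz
  · have hre : x.re = 2 * k * Real.pi + y.re := by simp [hk]
    have hpi := Real.pi_pos
    have hk₁ : (k : ℝ) < 1 := by nlinarith
    have hk₂ : (-1 : ℝ) < k := by nlinarith
    have hk₀ : k = 0 := by
      have : k < 1 := by exact_mod_cast hk₁
      have : -1 < k := by exact_mod_cast hk₂
      omega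
    simp [hk, hk₀]
  · have him : x.im = -y.im := by simp [hk]
    linarith

lemma Complex.sin_ne_zero_of_im_ne_zero {z : ℂ} (hz : z.im ≠ 0) : Complex.sin z ≠ 0 := by
  rw [Complex.sin_ne_zero_iff]
  rintro k rfl
  simp at hz

open scoped Topology in
/-- Near a point which is not real, the complex cosine has an analytic local inverse. -/
lemma Complex.exists_analyticAt_cos_rightInverse {z : ℂ} (hz : z.im ≠ 0) :
    ∃ g : ℂ → ℂ, AnalyticAt ℂ g (Complex.cos z) ∧ g (Complex.cos z) = z ∧
      ∀ᶠ w in 𝓝 (Complex.cos z), Complex.cos (g w) = w := by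
  have hcos : AnalyticAt ℂ Complex.cos z := Complex.analyticAt_cos
  have hderiv : deriv Complex.cos z ≠ 0 := by
    simpa using Complex.sin_ne_zero_of_im_ne_zero hz
  exact ⟨_, hcos.analyticAt_localInverse hderiv, HasStrictFDerivAt.localInverse_apply_image ..,
    HasStrictDerivAt.eventually_right_inverse ..⟩

/-- for `λ` with `ρ₀⁻¹cos λ ∉ [−1,1]` there is a unique `ξ` in the half-strip
with `cos ξ = ρ₀⁻¹cos λ`, and locally `ξ` can be chosen holomorphically with values in the
upper half-plane. -/
theorem stmt10 (ρ₀ : ℝ) (h₁ : 0 < ρ₀) (h₂ : ρ₀ < 1) :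
    (∀ lam : ℂ,
      ((ρ₀ : ℂ))⁻¹ * Complex.cos lam ∉ (Complex.ofReal '' Set.Icc (-1 : ℝ) 1) →
      ∃! ξ : ℂ, 0 < ξ.im ∧ -Real.pi < ξ.re ∧ ξ.re ≤ Real.pi ∧
        Complex.cos ξ = ((ρ₀ : ℂ))⁻¹ * Complex.cos lam) ∧
    (∀ lam₀ : ℂ,
      ((ρ₀ : ℂ))⁻¹ * Complex.cos lam₀ ∉ (Complex.ofReal '' Set.Icc (-1 : ℝ) 1) →
      ∃ V : Set ℂ, IsOpen V ∧ lam₀ ∈ V ∧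
        (∀ lam ∈ V, ((ρ₀ : ℂ))⁻¹ * Complex.cos lam ∉ (Complex.ofReal '' Set.Icc (-1 : ℝ) 1)) ∧
        ∃ ξf : ℂ → ℂ, DifferentiableOn ℂ ξf V ∧
          ∀ lam ∈ V, 0 < (ξf lam).im ∧
            Complex.cos (ξf lam) = ((ρ₀ : ℂ))⁻¹ * Complex.cos lam) := by
  refine ⟨fun lam h => Complex.existsUnique_cos_eq h, fun lam₀ h => ?_⟩
  obtain ⟨z, hz, hzw⟩ := Complex.exists_im_pos_cos_eq h
  obtain ⟨g, hg, hgz, hcos⟩ := Complex.exists_analyticAt_cos_rightInverse hz.ne'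
  rw [hzw] at hg hgz hcos
  have him : ∀ᶠ w in nhds ((ρ₀ : ℂ)⁻¹ * Complex.cos lam₀), 0 < (g w).im :=
    (Complex.continuous_im.continuousAt.comp hg.continuousAt).eventually_const_lt
      (by simpa [hgz] using hz)
  have hclosed : IsClosed (Complex.ofReal '' Set.Icc (-1 : ℝ) 1) :=
    (isCompact_Icc.image Complex.continuous_ofReal).isClosed
  obtain ⟨U, hU, hUo, hmem⟩ := eventually_nhds_iff.1
    (((hg.eventually_analyticAt.and hcos).and him).and (hclosed.isOpen_compl.eventually_mem h))
  have hf : Differentiable ℂ fun lam : ℂ => (ρ₀ : ℂ)⁻¹ * Complex.cos lam := by fun_prop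
  refine ⟨_, hUo.preimage hf.continuous, hmem, fun lam hlam => (hU _ hlam).2,
    fun lam => g ((ρ₀ : ℂ)⁻¹ * Complex.cos lam), fun lam hlam => ?_, fun lam hlam => ?_⟩
  · exact ((hU _ hlam).1.1.1.differentiableAt.comp lam hf.differentiableAt).differentiableWithinAt
  · exact ⟨(hU _ hlam).1.2, (hU _ hlam).1.1.2⟩
end
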